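/- Fix a real constant C > 1, p ∈ (0, 1/2), and a real constant A > 0. There exist a constant K > 0 and an integer D0 such that for every integer D ≥ D0 there exists ℓ0 such that the following holds for all integers ℓ ≥ ℓ0, k = D²ℓ², and 1 ≤ r ≤ Cℓ: setting c = c_{k,p} and H = −c/√k − A/(D√k), for every fixed unit vector e ∈ ℝ^{k−r+1} and y sampled from the uniform probability measure on the unit sphere S^{k−r} ⊆ ℝ^{k−r+1}, one has |ℙ(⟨y, e⟩ ≤ H) − (p − (A/(√(2π)·D))·e^{−c²/2})| ≤ K/D². -/

import Mathlib

open MeasureTheory Real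
open scoped ENNReal RealInnerProductSpace BigOperators

noncomputable section

/-- The ambient Euclidean space `ℝ^{k+1}`. -/
abbrev Amb (k : ℕ) := EuclideanSpace ℝ (Fin (k + 1))

/-- The surface measure on the unit sphere `S^k ⊆ ℝ^{k+1}`, as a measure on the
ambient space. -/
def sphereSurface (k : ℕ) : Measure (Amb k) :=
  ((volume : Measure (Amb k)).toSphere).map Subtype.val

/-- The uniform probability measure `ℙ` on the unit sphere `S^k ⊆ ℝ^{k+1}`
(normalized surface measure), as a measure on the ambient space. -/
def sphereUniform (k : ℕ) : Measure (Amb k) :=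
  (sphereSurface k Set.univ)⁻¹ • sphereSurface k

/-- `c` is the constant `c_{k,p}`: `c ≥ 0` and for a (fixed, arbitrary) unit vector `e`,
`ℙ(⟨x, e⟩ ≤ -c/√k) = p`. -/
def IsCkp (k : ℕ) (p c : ℝ) : Prop :=
  0 ≤ c ∧ ∀ e : Amb k, ‖e‖ = 1 →
    sphereUniform k {x | ⟪x, e⟫ ≤ -c / Real.sqrt k} = ENNReal.ofReal p

/-- `p` is the constant `p_C`: the unique `p ∈ (0,1/2)` with `C = log p / log (1-p)`. -/
def IsPC (C p : ℝ) : Prop :=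
  p ∈ Set.Ioo (0 : ℝ) (1 / 2) ∧ C = Real.log p / Real.log (1 - p)

section

open ProbabilityTheory

lemma withDensity_exp_neg_norm_sq_eq_smul_stdGaussian (E : Type*) [NormedAddCommGroup E]
    [InnerProductSpace ℝ E] [FiniteDimensional ℝ E] [MeasurableSpace E] [BorelSpace E] :
    (volume : Measure E).withDensity (fun x => ENNReal.ofReal (exp (-(1 / 2) * ‖x‖ ^ 2))) =
      ENNReal.ofReal ((π / (1 / 2)) ^ (Module.finrank ℝ E / 2 : ℝ)) • stdGaussian E := by
  have hint : Integrable (fun x : E => exp (-(1 / 2) * ‖x‖ ^ 2)) := by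
    have h := (GaussianFourier.integrable_cexp_neg_mul_sq_norm_add (b := 1 / 2) (by norm_num) 0
      (0 : E)).norm
    refine h.congr (Filter.Eventually.of_forall fun x => ?_)
    have hx : (-(1 / 2) * (‖x‖ : ℂ) ^ 2 + 0 * (⟪(0 : E), x⟫ : ℝ)) =
        ((-(1 / 2) * ‖x‖ ^ 2 : ℝ) : ℂ) := by
      push_cast
      ring
    simp only [hx, Complex.norm_exp, Complex.ofReal_re]
  have hfin : IsFiniteMeasure ((volume : Measure E).withDensity
      (fun x => ENNReal.ofReal (exp (-(1 / 2) * ‖x‖ ^ 2)))) :=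
    isFiniteMeasure_withDensity_ofReal hint.2
  have hfin' : IsFiniteMeasure
      (ENNReal.ofReal ((π / (1 / 2)) ^ (Module.finrank ℝ E / 2 : ℝ)) • stdGaussian E) :=
    Measure.smul_finite _ ENNReal.ofReal_ne_top
  refine Measure.ext_of_charFun (funext fun t => ?_)
  have hG := charFun_stdGaussian t
  rw [charFun_apply] at hG
  rw [charFun_apply, charFun_apply, integral_smul_measure, hG,
    integral_withDensity_eq_integral_toReal_smul (by fun_prop) (by simp),
    ENNReal.toReal_ofReal (by positivity)]
  have h := GaussianFourier.integral_cexp_neg_mul_sq_norm_add (b := 1 / 2) (by norm_num) Complex.I t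
  have hZ : (((π / (1 / 2)) ^ (Module.finrank ℝ E / 2 : ℝ) : ℝ) : ℂ) =
      ((π : ℂ) / (1 / 2)) ^ (Module.finrank ℝ E / 2 : ℂ) := by
    rw [Complex.ofReal_cpow (by positivity)]
    push_cast
    rfl
  rw [Complex.real_smul, hZ]
  convert! h using 2
  · ext x
    rw [ENNReal.toReal_ofReal (exp_pos _).le, Complex.real_smul, Complex.ofReal_exp,
      ← Complex.exp_add, real_inner_comm]
    push_cast
    ring_nf
  · rw [Complex.I_sq]
    ring_nf

lemma withDensity_norm_cone (E : Type*) [NormedAddCommGroup E] [InnerProductSpace ℝ E]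
    [FiniteDimensional ℝ E] [Nontrivial E] [MeasurableSpace E] [BorelSpace E] {f : ℝ → ℝ≥0∞}
    (hf : Measurable f) {S : Set E} (hS : MeasurableSet S)
    (hcone : ∀ r : ℝ, 0 < r → ∀ x, r • x ∈ S ↔ x ∈ S) :
    (volume : Measure E).withDensity (fun x => f ‖x‖) S =
      (volume : Measure E).toSphere (Subtype.val ⁻¹' S) *
        ∫⁻ r, f r.1 ∂(Measure.volumeIoiPow (Module.finrank ℝ E - 1)) := by
  have hmp := (volume : Measure E).measurePreserving_homeomorphUnitSphereProd
  have hemb := (homeomorphUnitSphereProd E).measurableEmbedding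
  have hS' : MeasurableSet ((Subtype.val : Metric.sphere (0 : E) 1 → E) ⁻¹' S) :=
    measurable_subtype_coe hS
  let g : Metric.sphere (0 : E) 1 × Set.Ioi (0 : ℝ) → ℝ≥0∞ := fun q =>
    (Subtype.val ⁻¹' S).indicator 1 q.1 * f q.2.1
  have key : ∀ x : ({(0)}ᶜ : Set E), S.indicator (fun x => f ‖x‖) x.1 =
      g (homeomorphUnitSphereProd E x) := by
    rintro ⟨x, hx⟩
    have hx0 : 0 < ‖x‖ := norm_pos_iff.2 hx
    have := hcone ‖x‖⁻¹ (inv_pos.2 hx0) x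
    by_cases h : x ∈ S <;> simp [g, Set.indicator, h, this]
  rw [withDensity_apply _ hS, ← lintegral_indicator hS]
  conv_lhs => rw [← restrict_compl_singleton (μ := volume) (0 : E)]
  rw [← lintegral_subtype_comap (measurableSet_singleton _).compl, lintegral_congr key,
    hmp.lintegral_comp_emb hemb g, ← lintegral_indicator_one hS']
  exact lintegral_prod_mul (measurable_one.indicator hS').aemeasurable
    (hf.comp measurable_subtype_coe).aemeasurable

lemma sphereUniform_apply_eq_stdGaussian (n : ℕ) (e : Amb n) (t : ℝ) :
    sphereUniform n {x | ⟪x, e⟫ ≤ t} = stdGaussian (Amb n) {x | ⟪x, e⟫ ≤ t * ‖x‖} := by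
  have hcont : Measurable fun r : ℝ => ENNReal.ofReal (exp (-(1 / 2) * r ^ 2)) := by fun_prop
  have hS : MeasurableSet {x : Amb n | ⟪x, e⟫ ≤ t * ‖x‖} :=
    measurableSet_le (by fun_prop) (by fun_prop)
  have hT : MeasurableSet {x : Amb n | ⟪x, e⟫ ≤ t} :=
    measurableSet_le (by fun_prop) (by fun_prop)
  have h1 := withDensity_norm_cone (Amb n) hcont hS (fun r hr x => by
    simp only [Set.mem_ofPred_eq, real_inner_smul_left, norm_smul, norm_of_nonneg hr.le]
    rw [show t * (r * ‖x‖) = r * (t * ‖x‖) by ring, mul_le_mul_iff_right₀ hr])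
  have h2 := withDensity_norm_cone (Amb n) hcont MeasurableSet.univ (fun r hr x => by simp)
  have hpre : (Subtype.val : Metric.sphere (0 : Amb n) 1 → Amb n) ⁻¹' {x | ⟪x, e⟫ ≤ t * ‖x‖} =
      Subtype.val ⁻¹' {x | ⟪x, e⟫ ≤ t} := by
    ext x
    simp
  rw [withDensity_exp_neg_norm_sq_eq_smul_stdGaussian, Measure.smul_apply, smul_eq_mul] at h1 h2
  rw [measure_univ, mul_one, Set.preimage_univ] at h2
  rw [hpre, h2] at h1
  set I := ∫⁻ r, ENNReal.ofReal (exp (-(1 / 2) * r.1 ^ 2))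
    ∂(Measure.volumeIoiPow (Module.finrank ℝ (Amb n) - 1))
  have hZ0 : ENNReal.ofReal ((π / (1 / 2)) ^ (Module.finrank ℝ (Amb n) / 2 : ℝ)) ≠ 0 := by
    rw [ne_eq, ENNReal.ofReal_eq_zero, not_le]
    positivity
  rw [h2] at hZ0
  have hI0 : I ≠ 0 := right_ne_zero_of_mul hZ0
  have hu0 := left_ne_zero_of_mul hZ0
  have hItop : I ≠ ⊤ := by
    intro h
    rw [h, ENNReal.mul_top hu0] at h2
    exact ENNReal.ofReal_ne_top h2
  rw [sphereUniform, sphereSurface, Measure.smul_apply, smul_eq_mul,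
    Measure.map_apply measurable_subtype_coe .univ, Measure.map_apply measurable_subtype_coe hT,
    Set.preimage_univ]
  have h3 : (volume : Measure (Amb n)).toSphere Set.univ *
      stdGaussian (Amb n) {x | ⟪x, e⟫ ≤ t * ‖x‖} =
      (volume : Measure (Amb n)).toSphere (Subtype.val ⁻¹' {x | ⟪x, e⟫ ≤ t}) := by
    refine (ENNReal.mul_left_inj hI0 hItop).1 ?_
    rw [← h1]
    ring
  rw [← h3, ← mul_assoc, ENNReal.inv_mul_cancel hu0 (measure_ne_top _ _), one_mul]

lemma stdGaussian_map_inner (n : ℕ) {e : Amb n} (he : ‖e‖ = 1) :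
    (stdGaussian (Amb n)).map (fun x => ⟪x, e⟫) = gaussianReal 0 1 := by
  have h := IsGaussian.map_eq_gaussianReal (μ := stdGaussian (Amb n)) (innerSL ℝ e)
  rw [integral_strongDual_stdGaussian, variance_dual_stdGaussian, innerSL_apply_norm, he] at h
  simpa [innerSL_apply_apply, real_inner_comm] using h

lemma tendsto_stdGaussian_norm_sq_deviation {ε : ℝ} (hε : 0 < ε) :
    Filter.Tendsto (fun n : ℕ => (stdGaussian (Amb n)).real {x | ε * n ≤ |‖x‖ ^ 2 - n|})
      Filter.atTop (nhds 0) := by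
  set V := Var[fun x : ℝ => x ^ 2; gaussianReal 0 1]
  have hmem : MemLp (fun x : ℝ => x ^ 2) 2 (gaussianReal 0 1) := by
    have h := (memLp_id_gaussianReal' (μ := 0) (v := 1) (2 * 2) (by norm_num)).norm_rpow_div 2
    rw [ENNReal.mul_div_cancel_right (by norm_num) (by norm_num)] at h
    simpa using h
  have hmean : ∫ x : ℝ, x ^ 2 ∂(gaussianReal 0 1) = 1 := by
    have h := variance_id_gaussianReal (μ := 0) (v := 1)
    rw [variance_eq_sub (by exact memLp_id_gaussianReal 2)] at h
    simpa using h
  have hbound : ∀ n : ℕ, 2 / ε ≤ n →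
      (stdGaussian (Amb n)).real {x | ε * n ≤ |‖x‖ ^ 2 - n|} ≤ (n + 1) * V / (ε * n / 2) ^ 2 := by
    intro n hn
    have hn0 : 0 < (n : ℝ) := lt_of_lt_of_le (by positivity) hn
    have hn1 : 1 ≤ ε * n / 2 := by
      rw [div_le_iff₀ hε] at hn
      linarith
    set X : (Fin (n + 1) → ℝ) → ℝ := ∑ i, fun ω => (ω i) ^ 2
    have hX : X = fun ω => ∑ i, (ω i) ^ 2 := by
      ext ω
      simp [X]
    have hmem' : ∀ i : Fin (n + 1), MemLp (fun ω : Fin (n + 1) → ℝ => (ω i) ^ 2) 2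
        (Measure.pi fun _ => gaussianReal 0 1) := fun i =>
      hmem.comp_measurePreserving (measurePreserving_eval _ i)
    have hXmem : MemLp X 2 (Measure.pi fun _ => gaussianReal 0 1) :=
      memLp_finsetSum' _ fun i _ => hmem' i
    have hvar : Var[X; Measure.pi fun _ => gaussianReal 0 1] = (n + 1) * V := by
      rw [variance_sum_pi (X := fun _ x => x ^ 2) fun _ => hmem]
      simp [V]
    have hmeanX : ∫ ω, X ω ∂(Measure.pi fun _ => gaussianReal 0 1) = n + 1 := by
      rw [hX, integral_finsetSum _ fun i _ => (hmem' i).integrable (by norm_num)]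
      have : ∀ i : Fin (n + 1), ∫ ω : Fin (n + 1) → ℝ, (ω i) ^ 2
          ∂(Measure.pi fun _ => gaussianReal 0 1) = 1 := fun i => by
        rw [← hmean]
        exact integral_comp_eval (μ := fun _ : Fin (n + 1) => gaussianReal 0 1) (i := i)
          (f := fun x : ℝ => x ^ 2) (by fun_prop)
      simp [this]
    have hcheb := meas_ge_le_variance_div_sq hXmem (c := ε * n / 2) (by positivity)
    rw [hvar, hmeanX] at hcheb
    have hmeas : MeasurableSet {x : Amb n | ε * n ≤ |‖x‖ ^ 2 - n|} :=
      measurableSet_le (by fun_prop) (by fun_prop)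
    refine ENNReal.toReal_le_of_le_ofReal
      (div_nonneg (mul_nonneg (by positivity) (variance_nonneg _ _)) (by positivity)) ?_
    rw [← map_pi_eq_stdGaussian, Measure.map_apply (by fun_prop) hmeas]
    refine (measure_mono fun ω hω => ?_).trans hcheb
    simp only [Set.mem_preimage, Set.mem_ofPred_eq, EuclideanSpace.real_norm_sq_eq] at hω
    simp only [hX, Set.mem_ofPred_eq]
    have h := abs_sub_abs_le_abs_sub (∑ i, ω i ^ 2 - n : ℝ) 1
    rw [abs_one, sub_sub] at h
    linarith
  have hlim : Filter.Tendsto (fun n : ℕ => ((n : ℝ) + 1) * V / (ε * n / 2) ^ 2)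
      Filter.atTop (nhds 0) := by
    have h1 := tendsto_one_div_atTop_nhds_zero_nat (𝕜 := ℝ)
    have h2 : Filter.Tendsto (fun n : ℕ => (4 * V / ε ^ 2) * (1 / (n : ℝ) + (1 / n) * (1 / n)))
        Filter.atTop (nhds 0) := by
      simpa using (h1.add (h1.mul h1)).const_mul (4 * V / ε ^ 2)
    refine h2.congr' ?_
    filter_upwards [Filter.eventually_gt_atTop 0] with n hn
    have : (n : ℝ) ≠ 0 := by positivity
    field_simp
    ring
  refine squeeze_zero' (Filter.Eventually.of_forall fun n => measureReal_nonneg) ?_ hlim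
  filter_upwards [Filter.eventually_ge_atTop ⌈2 / ε⌉₊] with n hn
  exact hbound n (Nat.ceil_le.1 hn)

lemma gaussianReal_real_Iic_sub_eq_intervalIntegral {a b : ℝ} (hab : a ≤ b) :
    (gaussianReal 0 1).real (Set.Iic b) - (gaussianReal 0 1).real (Set.Iic a) =
      ∫ x in a..b, gaussianPDFReal 0 1 x := by
  rw [← Set.Iic_union_Ioc_eq_Iic hab, measureReal_union (by simp) measurableSet_Ioc,
    add_sub_cancel_left, measureReal_def, gaussianReal_apply_eq_integral _ one_ne_zero,
    ENNReal.toReal_ofReal (integral_nonneg fun x => gaussianPDFReal_nonneg _ _ _),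
    intervalIntegral.integral_of_le hab]

lemma gaussianPDFReal_zero_one (x : ℝ) :
    gaussianPDFReal 0 1 x = (√(2 * π))⁻¹ * exp (-x ^ 2 / 2) := by
  simp [gaussianPDFReal]

lemma abs_mul_gaussianPDFReal_le_one (x : ℝ) : |x| * gaussianPDFReal 0 1 x ≤ 1 := by
  have h1 : 1 ≤ √(2 * π) := by
    rw [one_le_sqrt]
    linarith [pi_gt_three]
  have h2 : |x| ≤ exp (x ^ 2 / 2) := by
    have := add_one_le_exp (x ^ 2 / 2)
    nlinarith [sq_abs x, sq_nonneg (|x| - 1)]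
  rw [gaussianPDFReal_zero_one, neg_div, exp_neg, ← mul_inv, ← div_eq_mul_inv,
    div_le_one (by positivity)]
  nlinarith [exp_pos (x ^ 2 / 2)]

lemma gaussianReal_real_Iic_mul_sub_le {s t : ℝ} (hs : 1 / 2 ≤ s) (hs1 : s ≤ 1) (ht : t ≤ 0) :
    (gaussianReal 0 1).real (Set.Iic (s * t)) - (gaussianReal 0 1).real (Set.Iic t) ≤
      2 * (1 - s) := by
  have hst : t ≤ s * t := by nlinarith
  rw [gaussianReal_real_Iic_sub_eq_intervalIntegral hst]
  have hmono : ∀ x ∈ Set.Icc t (s * t), gaussianPDFReal 0 1 x ≤ gaussianPDFReal 0 1 (s * t) := by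
    intro x hx
    rw [gaussianPDFReal_zero_one, gaussianPDFReal_zero_one]
    gcongr ?_ * exp (-?_ / 2)
    exact sq_le_sq.2 (abs_le_abs_of_nonpos (by nlinarith) hx.2)
  have hle := intervalIntegral.integral_mono_on hst
    (integrable_gaussianPDFReal 0 1).intervalIntegrable (intervalIntegrable_const (μ := volume)) hmono
  rw [intervalIntegral.integral_const, smul_eq_mul] at hle
  have h := abs_mul_gaussianPDFReal_le_one (s * t)
  rw [abs_of_nonpos (by nlinarith)] at h
  have h3 := gaussianPDFReal_nonneg 0 1 (s * t)
  have h4 : -t * gaussianPDFReal 0 1 (s * t) ≤ 2 := by nlinarith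
  nlinarith

lemma abs_gaussianPDFReal_sub_le (x y : ℝ) :
    |gaussianPDFReal 0 1 x - gaussianPDFReal 0 1 y| ≤ |x - y| := by
  have hderiv : ∀ z : ℝ, HasDerivAt (gaussianPDFReal 0 1) (-z * gaussianPDFReal 0 1 z) z := by
    intro z
    have h : HasDerivAt (fun z : ℝ => (√(2 * π))⁻¹ * exp (-z ^ 2 / 2))
        ((√(2 * π))⁻¹ * (exp (-z ^ 2 / 2) * (-(2 * z) / 2))) z := by
      have := ((((hasDerivAt_id z).pow 2).neg.div_const 2).exp).const_mul ((√(2 * π))⁻¹)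
      simpa using this
    rw [show gaussianPDFReal 0 1 = fun z : ℝ => (√(2 * π))⁻¹ * exp (-z ^ 2 / 2) from
      funext gaussianPDFReal_zero_one]
    convert h using 1
    ring
  have h := convex_univ.norm_image_sub_le_of_norm_hasDerivWithin_le
    (f := gaussianPDFReal 0 1) (C := 1) (fun z _ => (hderiv z).hasDerivWithinAt) (fun z _ => ?_)
    (Set.mem_univ y) (Set.mem_univ x)
  · simpa using h
  · rw [norm_mul, norm_neg, norm_eq_abs, norm_of_nonneg (gaussianPDFReal_nonneg _ _ _)]
    exact abs_mul_gaussianPDFReal_le_one z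

lemma abs_gaussianReal_real_Iic_sub_taylor_le (x : ℝ) {h : ℝ} (hh : 0 ≤ h) :
    |(gaussianReal 0 1).real (Set.Iic (x - h)) -
      ((gaussianReal 0 1).real (Set.Iic x) - h * gaussianPDFReal 0 1 x)| ≤ h ^ 2 := by
  have hint : IntervalIntegrable (gaussianPDFReal 0 1) volume (x - h) x :=
    (integrable_gaussianPDFReal 0 1).intervalIntegrable
  have h1 := gaussianReal_real_Iic_sub_eq_intervalIntegral (a := x - h) (b := x) (by linarith)
  have h2 : ∫ y in (x - h)..x, (gaussianPDFReal 0 1 y - gaussianPDFReal 0 1 x) =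
      (∫ y in (x - h)..x, gaussianPDFReal 0 1 y) - h * gaussianPDFReal 0 1 x := by
    rw [intervalIntegral.integral_sub hint intervalIntegrable_const,
      intervalIntegral.integral_const, smul_eq_mul, sub_sub_cancel]
  have h3 := intervalIntegral.norm_integral_le_of_norm_le_const (a := x - h) (b := x) (C := h)
    (f := fun y => gaussianPDFReal 0 1 y - gaussianPDFReal 0 1 x) (fun y hy => by
      rw [Set.uIoc_of_le (by linarith)] at hy
      refine (abs_gaussianPDFReal_sub_le y x).trans ?_
      rw [abs_le]
      constructor <;> linarith [hy.1, hy.2])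
  rw [h2, sub_sub_cancel, abs_of_nonneg hh, norm_eq_abs, abs_le] at h3
  rw [abs_le]
  constructor <;> nlinarith [h3.1, h3.2]

lemma stdGaussian_real_inner_le (n : ℕ) {e : Amb n} (he : ‖e‖ = 1) (a : ℝ) :
    (stdGaussian (Amb n)).real {x | ⟪x, e⟫ ≤ a} = (gaussianReal 0 1).real (Set.Iic a) := by
  rw [← stdGaussian_map_inner n he, map_measureReal_apply (by fun_prop) measurableSet_Iic]
  rfl

lemma exists_forall_abs_sphereUniform_halfspace_sub_le {η : ℝ} (hη : 0 < η) :
    ∃ N : ℕ, ∀ n : ℕ, N ≤ n → ∀ e : Amb n, ‖e‖ = 1 → ∀ t : ℝ, t ≤ 0 →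
      |(sphereUniform n {x | ⟪x, e⟫ ≤ t / √n}).toReal - (gaussianReal 0 1).real (Set.Iic t)|
        ≤ η := by
  obtain ⟨ε, hε, hε2, hεη⟩ : ∃ ε : ℝ, 0 < ε ∧ ε ≤ 1 / 2 ∧ ε ≤ η / 4 :=
    ⟨min (1 / 2) (η / 4), by positivity, min_le_left _ _, min_le_right _ _⟩
  obtain ⟨N, hN⟩ := Filter.eventually_atTop.1
    ((tendsto_stdGaussian_norm_sq_deviation hε).eventually_lt_const (half_pos hη))
  refine ⟨N + 1, fun n hn e he t ht => ?_⟩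
  have hn0 : 0 < (n : ℝ) := by exact_mod_cast Nat.lt_of_lt_of_le N.succ_pos hn
  have hdev := hN n (by omega)
  set B := {x : Amb n | ε * n ≤ |‖x‖ ^ 2 - n|}
  have hnorm : ∀ x ∉ B, 1 - ε ≤ ‖x‖ / √n ∧ ‖x‖ / √n ≤ 1 + ε := by
    intro x hx
    simp only [B, Set.mem_ofPred_eq, not_le, abs_lt] at hx
    have hsq : (‖x‖ / √n) ^ 2 * n = ‖x‖ ^ 2 := by
      rw [div_pow, sq_sqrt hn0.le, div_mul_cancel₀ _ hn0.ne']
    have hρ : 0 ≤ ‖x‖ / √n := by positivity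
    have h1 : 1 - ε < (‖x‖ / √n) ^ 2 := by nlinarith
    have h2 : (‖x‖ / √n) ^ 2 < 1 + ε := by nlinarith
    constructor <;> nlinarith
  have hscale : ∀ x : Amb n, t / √n * ‖x‖ = ‖x‖ / √n * t := fun x => by ring
  have hup : (stdGaussian (Amb n)).real {x | ⟪x, e⟫ ≤ t / √n * ‖x‖} ≤
      (gaussianReal 0 1).real (Set.Iic ((1 - ε) * t)) + η / 2 := by
    rw [← stdGaussian_real_inner_le n he]
    refine (measureReal_mono (s₂ := {x | ⟪x, e⟫ ≤ (1 - ε) * t} ∪ B) fun x hx => ?_).trans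
      ((measureReal_union_le _ _).trans (by gcongr))
    by_cases hxB : x ∈ B
    · exact Or.inr hxB
    · refine Or.inl ?_
      rw [Set.mem_ofPred_eq] at hx ⊢
      refine hx.trans ?_
      rw [hscale]
      nlinarith [hnorm x hxB]
  have hlow : (gaussianReal 0 1).real (Set.Iic ((1 + ε) * t)) ≤
      (stdGaussian (Amb n)).real {x | ⟪x, e⟫ ≤ t / √n * ‖x‖} + η / 2 := by
    rw [← stdGaussian_real_inner_le n he]
    refine (measureReal_mono (s₂ := {x | ⟪x, e⟫ ≤ t / √n * ‖x‖} ∪ B) fun x hx => ?_).trans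
      ((measureReal_union_le _ _).trans (by gcongr))
    by_cases hxB : x ∈ B
    · exact Or.inr hxB
    · refine Or.inl ?_
      rw [Set.mem_ofPred_eq] at hx ⊢
      refine hx.trans ?_
      rw [hscale]
      nlinarith [hnorm x hxB]
  have h1 := gaussianReal_real_Iic_mul_sub_le (s := 1 - ε) (by linarith) (by linarith) ht
  have h2 := gaussianReal_real_Iic_mul_sub_le (s := (1 + ε)⁻¹) (t := (1 + ε) * t)
    (by rw [one_div]; exact inv_anti₀ (by linarith) (by linarith))
    (inv_le_one_of_one_le₀ (by linarith)) (by nlinarith)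
  rw [inv_mul_cancel_left₀ (by linarith)] at h2
  have h3 : 1 - ε ≤ (1 + ε)⁻¹ := by
    rw [← one_div, le_div_iff₀ (by linarith)]
    nlinarith
  rw [sphereUniform_apply_eq_stdGaussian, ← measureReal_def, abs_le]
  constructor <;> linarith

end

/-!
Statement 4 (Lemma `limrk3`): fix `C > 1`, `p ∈ (0,1/2)`, `A > 0`.  There are `K > 0`
and `D0` such that for every `D ≥ D0` there is `ℓ0` such that for all `ℓ ≥ ℓ0`,
`k = D²ℓ²`, `1 ≤ r ≤ Cℓ`, with `c = c_{k,p}` and `H = -c/√k - A/(D√k)`, for every unit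
vector `e ∈ ℝ^{k-r+1}` and `y` uniform on `S^{k-r}`,
`|ℙ(⟨y,e⟩ ≤ H) - (p - (A/(√(2π)D))·e^{-c²/2})| ≤ K/D²`.
-/

theorem limrk3 (C : ℝ) (hC : 1 < C) (p : ℝ) (hp : p ∈ Set.Ioo (0 : ℝ) (1 / 2))
    (A : ℝ) (hA : 0 < A) :
    ∃ K : ℝ, 0 < K ∧ ∃ D0 : ℕ, ∀ D : ℕ, D0 ≤ D → ∃ ℓ0 : ℕ, ∀ ℓ : ℕ, ℓ0 ≤ ℓ →
      ∀ k : ℕ, k = D ^ 2 * ℓ ^ 2 →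
        ∀ r : ℕ, 1 ≤ r → (r : ℝ) ≤ C * ℓ →
          ∀ c : ℝ, IsCkp k p c →
            ∀ e : Amb (k - r), ‖e‖ = 1 →
              |(sphereUniform (k - r)
                  {y | ⟪y, e⟫ ≤ -c / Real.sqrt k - A / (D * Real.sqrt k)}).toReal -
                (p - A / (Real.sqrt (2 * Real.pi) * D) * Real.exp (-c ^ 2 / 2))|
                ≤ K / D ^ 2 := by
  refine ⟨3 + A ^ 2, by positivity, 1, fun D hD => ?_⟩
  have hD1 : (1 : ℝ) ≤ D := by exact_mod_cast hD
  have hη : 0 < 1 / (D : ℝ) ^ 2 := by positivity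
  obtain ⟨N, hN⟩ := exists_forall_abs_sphereUniform_halfspace_sub_le hη
  refine ⟨⌈2 * C * D ^ 2⌉₊ + 2 * N + 1, fun ℓ hℓ k hk r hr hrC c hc e he => ?_⟩
  have hℓ1 : (1 : ℝ) ≤ ℓ := by exact_mod_cast (show 1 ≤ ℓ by omega)
  have hℓC : 2 * C * D ^ 2 ≤ ℓ := Nat.ceil_le.1 (by omega)
  have hℓN : 2 * (N : ℝ) ≤ ℓ := by exact_mod_cast (show 2 * N ≤ ℓ by omega)
  have hkR : (k : ℝ) = D ^ 2 * ℓ ^ 2 := by exact_mod_cast hk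
  have hk0 : 0 < (k : ℝ) := by rw [hkR]; positivity
  have hD2 : (1 : ℝ) ≤ D ^ 2 := one_le_pow₀ hD1
  have hkℓ : (ℓ : ℝ) ≤ k := by rw [hkR]; nlinarith [sq_nonneg (ℓ : ℝ)]
  have hrk : (r : ℝ) ≤ 1 / (D : ℝ) ^ 2 / 2 * k := by
    rw [hkR, show 1 / (D : ℝ) ^ 2 / 2 * (D ^ 2 * ℓ ^ 2) = ℓ ^ 2 / 2 by field_simp]
    nlinarith
  have hη1 : 1 / (D : ℝ) ^ 2 ≤ 1 := by rw [div_le_one (by positivity)]; exact hD2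
  have hrk2 : 2 * (r : ℝ) ≤ k := by nlinarith
  have hrk' : r ≤ k := by
    have : (r : ℝ) ≤ k := by linarith
    exact_mod_cast this
  have hmR : ((k - r : ℕ) : ℝ) = k - r := Nat.cast_sub hrk'
  have hNm : N ≤ k - r := by
    have : (N : ℝ) ≤ (k - r : ℕ) := by rw [hmR]; linarith
    exact_mod_cast this
  have hm0 : 0 < ((k - r : ℕ) : ℝ) := by rw [hmR]; linarith
  set s := √((k - r : ℕ) : ℝ) / √k with hs
  have hs1 : s ≤ 1 := by
    rw [hs, div_le_one (by positivity)]
    exact sqrt_le_sqrt (by rw [hmR]; linarith [(Nat.cast_nonneg r : (0 : ℝ) ≤ r)])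
  have hs0 : 0 ≤ s := by positivity
  have hsm : s ^ 2 * k = k - r := by
    rw [hs, div_pow, sq_sqrt hm0.le, sq_sqrt hk0.le, div_mul_cancel₀ _ hk0.ne', hmR]
  have hsη : 1 - s ≤ 1 / (D : ℝ) ^ 2 / 2 := by
    have h1 : 1 - 1 / (D : ℝ) ^ 2 / 2 ≤ s ^ 2 := by
      refine le_of_mul_le_mul_right ?_ hk0
      linarith
    nlinarith
  obtain ⟨hc0, hcp⟩ := hc
  have hAD : 0 < A / D := by positivity
  have hp' := hN k (hNm.trans (Nat.sub_le _ _)) (EuclideanSpace.single 0 1) (by simp) (-c)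
    (by linarith)
  rw [hcp _ (by simp), ENNReal.toReal_ofReal hp.1.le] at hp'
  have hm := hN (k - r) hNm e he (s * (-c - A / D)) (by nlinarith)
  have hH : s * (-c - A / D) / √((k - r : ℕ) : ℝ) = -c / √k - A / (D * √k) := by
    rw [hs]
    field_simp
  rw [hH] at hm
  have hscale := gaussianReal_real_Iic_mul_sub_le (s := s) (t := -c - A / D)
    (by linarith) hs1 (by linarith)
  have hmono : (ProbabilityTheory.gaussianReal 0 1).real (Set.Iic (-c - A / D)) ≤
      (ProbabilityTheory.gaussianReal 0 1).real (Set.Iic (s * (-c - A / D))) :=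
    measureReal_mono (Set.Iic_subset_Iic.2 (by nlinarith))
  have htaylor := abs_gaussianReal_real_Iic_sub_taylor_le (-c) hAD.le
  have hφ : A / D * ProbabilityTheory.gaussianPDFReal 0 1 (-c) = A / (√(2 * π) * D) * exp (-c ^ 2 / 2) := by
    rw [gaussianPDFReal_zero_one, neg_sq]
    field_simp
  rw [hφ, div_pow] at htaylor
  have hK : (3 + A ^ 2) / (D : ℝ) ^ 2 = 3 * (1 / (D : ℝ) ^ 2) + A ^ 2 / (D : ℝ) ^ 2 := by ring
  rw [hK]
  rw [abs_le] at hp' hm htaylor ⊢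
  constructor <;> linarith
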